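/- If T satisfies T_xx + T_yy = 2T(T_x² + T_y²)/(1 + T²), then the 1-form η = −(1/2) d(log(1+T²)) + (T_y dx − T_x dy)/(1+T²) is closed; consequently on a simply connected domain there is R with d log R = η, and R is a common integrating factor for ω₁ = T dx + dy and ω₂ = −dx + T dy. -/

import Mathlib

/-- Partial derivative in the `x` direction. -/
noncomputable def pdx (f : ℝ × ℝ → ℝ) (p : ℝ × ℝ) : ℝ := fderiv ℝ f p (1, 0)
/-- Partial derivative in the `y` direction. -/
noncomputable def pdy (f : ℝ × ℝ → ℝ) (p : ℝ × ℝ) : ℝ := fderiv ℝ f p (0, 1)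

/-- On a simply connected, locally path connected space, a family of local functions whose
pairwise differences are locally constant can be glued to a global function, up to locally
constant functions. -/
theorem exists_forall_eventually_sub_eq {X ι G : Type*} [TopologicalSpace X]
    [SimplyConnectedSpace X] [LocallyPathConnectedSpace X] [AddCommGroup G]
    {s : ι → Set X} (hs : ∀ i, IsOpen (s i)) (hcov : ∀ x, ∃ i, x ∈ s i) {f : ι → X → G}
    (hf : ∀ i j, ∀ x ∈ s i ∩ s j, ∀ᶠ y in nhds x, f i y - f j y = f i x - f j x) :
    ∃ F : X → G, ∀ i, ∀ x ∈ s i, ∀ᶠ y in nhds x, F y - f i y = F x - f i x := by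
  let : TopologicalSpace G := ⊥
  have : DiscreteTopology G := ⟨rfl⟩
  choose k hk using hcov
  let Z : FiberBundleCore ι X G :=
    { baseSet := s
      isOpen_baseSet := hs
      indexAt := k
      mem_baseSet_at := hk
      coordChange := fun i j x v ↦ v + (f i x - f j x)
      coordChange_self := by simp
      continuousOn_coordChange := by
        rintro i j ⟨x, v⟩ ⟨hx, -⟩
        refine continuousAt_snd.continuousWithinAt.add (ContinuousAt.continuousWithinAt ?_)
        refine ContinuousAt.comp (f := Prod.fst) (g := fun y ↦ f i y - f j y) ?_ continuousAt_fst
        exact continuousAt_const.congr ((hf i j x hx).mono fun y hy ↦ hy.symm)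
      coordChange_comp := by intros; abel }
  obtain ⟨x₀⟩ : Nonempty X := inferInstance
  obtain ⟨σ, ⟨-, hσ⟩, -⟩ :=
    (FiberBundle.isCoveringMap (F := G) (E := Z.Fiber)).existsUnique_continuousMap_lifts
      (ContinuousMap.id X) x₀ (⟨x₀, (0 : G)⟩ : Z.TotalSpace) rfl
  have hproj (x : X) : (σ x).proj = x := congrFun hσ x
  refine ⟨fun x ↦ (id (σ x).snd : G) + f (k x) x, fun i x hx ↦ ?_⟩
  have hcont : ContinuousAt (fun y ↦ (Z.localTriv i (σ y)).2) x := by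
    refine continuousAt_snd.comp (ContinuousAt.comp ?_ σ.continuous.continuousAt)
    refine (Z.localTriv i).continuousAt ?_
    rw [Z.mem_localTriv_source, hproj]
    exact hx
  have hlc := hcont.eventually (p := fun v ↦ v = (Z.localTriv i (σ x)).2)
    (by rw [nhds_discrete]; simp)
  filter_upwards [hlc] with y hy
  simp only [Z.localTriv_apply, hproj] at hy
  exact (add_sub_assoc _ _ _).trans (hy.trans (add_sub_assoc _ _ _).symm)

/-- **Poincaré lemma** for 1-forms on a simply connected open set. -/
theorem IsSimplyConnected.exists_forall_hasFDerivAt {E F : Type*}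
    [NormedAddCommGroup E] [NormedSpace ℝ E] [NormedAddCommGroup F] [NormedSpace ℝ F]
    [CompleteSpace F] {U : Set E} (hsc : IsSimplyConnected U) (hU : IsOpen U)
    {ω : E → E →L[ℝ] F} (hω : DifferentiableOn ℝ ω U)
    (hdω : ∀ a ∈ U, ∀ x y, fderiv ℝ ω a x y = fderiv ℝ ω a y x) :
    ∃ f : E → F, ∀ a ∈ U, HasFDerivAt f (ω a) a := by
  classical
  have := hsc.simplyConnectedSpace
  have := hU.locallyPathConnectedSpace
  choose r hr hrU using fun i : U ↦ Metric.isOpen_iff.1 hU i i.2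
  choose f hf using fun i : U ↦
    (convex_ball (i : E) (r i)).exists_forall_hasFDerivAt_of_fderiv_symmetric Metric.isOpen_ball
      (hω.mono (hrU i)) fun a ha ↦ hdω a (hrU i ha)
  obtain ⟨g, hg⟩ := exists_forall_eventually_sub_eq (X := U)
    (s := fun i : U ↦ (↑) ⁻¹' Metric.ball (i : E) (r i)) (f := fun i x ↦ f i x)
    (fun i ↦ Metric.isOpen_ball.preimage continuous_subtype_val)
    (fun x ↦ ⟨x, Metric.mem_ball_self (hr x)⟩) (by
      intro i j x hx
      have hopen : IsOpen (Metric.ball (i : E) (r i) ∩ Metric.ball (j : E) (r j)) :=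
        Metric.isOpen_ball.inter Metric.isOpen_ball
      have hder (y) (hy : y ∈ Metric.ball (i : E) (r i) ∩ Metric.ball (j : E) (r j)) :
          HasFDerivAt (fun z ↦ f i z - f j z) (0 : E →L[ℝ] F) y := by
        simpa using (hf i y hy.1).fun_sub (hf j y hy.2)
      filter_upwards [(hopen.preimage continuous_subtype_val).mem_nhds hx] with y hy
      exact hopen.is_const_of_fderiv_eq_zero (𝕜 := ℝ) (f := fun z ↦ f i z - f j z)
        ((convex_ball _ _).inter (convex_ball _ _)).isPreconnected
        (fun z hz ↦ (hder z hz).differentiableAt.differentiableWithinAt)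
        (fun z hz ↦ (hder z hz).fderiv) hy hx)
  refine ⟨fun x ↦ if hx : x ∈ U then g ⟨x, hx⟩ else 0, fun a ha ↦ ?_⟩
  have haa := Metric.mem_ball_self (x := a) (hr ⟨a, ha⟩)
  refine ((hf ⟨a, ha⟩ a haa).add_const (g ⟨a, ha⟩ - f ⟨a, ha⟩ a)).congr_of_eventuallyEq ?_
  have h := hg ⟨a, ha⟩ ⟨a, ha⟩ haa
  rw [nhds_subtype_eq_comap, Filter.eventually_comap] at h
  filter_upwards [h, hU.mem_nhds ha] with y hy hyU
  rw [dif_pos hyU, ← hy ⟨y, hyU⟩ rfl]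
  abel

theorem HasFDerivAt.real_div {E : Type*} [NormedAddCommGroup E] [NormedSpace ℝ E] {f g : E → ℝ}
    {f' g' : E →L[ℝ] ℝ} {x : E} (hf : HasFDerivAt f f' x) (hg : HasFDerivAt g g' x)
    (hx : g x ≠ 0) :
    HasFDerivAt (fun y ↦ f y / g y) ((g x ^ 2)⁻¹ • (g x • f' - f x • g')) x := by
  simp only [div_eq_mul_inv]
  refine (hf.fun_mul ((hasDerivAt_inv hx).comp_hasFDerivAt x hg)).congr_fderiv ?_
  ext v
  simp only [add_apply, sub_apply, smul_apply, smul_eq_mul, Function.comp_apply]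
  field_simp
  ring

theorem HasFDerivAt.pdx_eq {f : ℝ × ℝ → ℝ} {f' : ℝ × ℝ →L[ℝ] ℝ} {p : ℝ × ℝ}
    (h : HasFDerivAt f f' p) : pdx f p = f' (1, 0) := by
  rw [pdx, h.fderiv]

theorem HasFDerivAt.pdy_eq {f : ℝ × ℝ → ℝ} {f' : ℝ × ℝ →L[ℝ] ℝ} {p : ℝ × ℝ}
    (h : HasFDerivAt f f' p) : pdy f p = f' (0, 1) := by
  rw [pdy, h.fderiv]

theorem ContDiffOn.pdx {f : ℝ × ℝ → ℝ} {U : Set (ℝ × ℝ)} (hU : IsOpen U)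
    (hf : ContDiffOn ℝ (⊤ : ℕ∞) f U) : ContDiffOn ℝ (⊤ : ℕ∞) (pdx f) U :=
  (hf.fderiv_of_isOpen hU (by simp)).clm_apply contDiffOn_const

theorem ContDiffOn.pdy {f : ℝ × ℝ → ℝ} {U : Set (ℝ × ℝ)} (hU : IsOpen U)
    (hf : ContDiffOn ℝ (⊤ : ℕ∞) f U) : ContDiffOn ℝ (⊤ : ℕ∞) (pdy f) U :=
  (hf.fderiv_of_isOpen hU (by simp)).clm_apply contDiffOn_const

theorem pdx_pdy_comm {f : ℝ × ℝ → ℝ} {p : ℝ × ℝ} (hf : ContDiffAt ℝ 2 f p) :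
    pdx (pdy f) p = pdy (pdx f) p := by
  have hd : HasFDerivAt (fderiv ℝ f) (fderiv ℝ (fderiv ℝ f) p) p :=
    ((hf.fderiv_right (m := 1) (by norm_num)).differentiableAt (by norm_num)).hasFDerivAt
  have hs : IsSymmSndFDerivAt ℝ f p := hf.isSymmSndFDerivAt (by simp)
  have h1 : HasFDerivAt (pdy f) _ p := hd.clm_apply (hasFDerivAt_const (0, 1) p)
  have h2 : HasFDerivAt (pdx f) _ p := hd.clm_apply (hasFDerivAt_const (1, 0) p)
  rw [h1.pdx_eq, h2.pdy_eq]
  simpa using hs.eq (1, 0) (0, 1)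

/-- A closed smooth 1-form `a dx + b dy` on a simply connected open subset of the plane has a
smooth potential. -/
theorem IsSimplyConnected.exists_potential {U : Set (ℝ × ℝ)} (hsc : IsSimplyConnected U)
    (hU : IsOpen U) {a b : ℝ × ℝ → ℝ} (ha : ContDiffOn ℝ (⊤ : ℕ∞) a U)
    (hb : ContDiffOn ℝ (⊤ : ℕ∞) b U) (hab : ∀ p ∈ U, pdy a p = pdx b p) :
    ∃ f : ℝ × ℝ → ℝ, ContDiffOn ℝ (⊤ : ℕ∞) f U ∧ (∀ p ∈ U, pdx f p = a p) ∧
      ∀ p ∈ U, pdy f p = b p := by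
  let ω : ℝ × ℝ → ℝ × ℝ →L[ℝ] ℝ := fun p ↦
    a p • ContinuousLinearMap.fst ℝ ℝ ℝ + b p • ContinuousLinearMap.snd ℝ ℝ ℝ
  have hω : ContDiffOn ℝ (⊤ : ℕ∞) ω U :=
    (ha.smul contDiffOn_const).add (hb.smul contDiffOn_const)
  obtain ⟨f, hf⟩ := hsc.exists_forall_hasFDerivAt hU (hω.differentiableOn (by simp)) (by
    intro p hp u v
    have hda := ((ha.differentiableOn (by simp)).differentiableAt (hU.mem_nhds hp)).hasFDerivAt
    have hdb := ((hb.differentiableOn (by simp)).differentiableAt (hU.mem_nhds hp)).hasFDerivAt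
    have hdω : HasFDerivAt ω _ p := (hda.smul_const (ContinuousLinearMap.fst ℝ ℝ ℝ)).add
      (hdb.smul_const (ContinuousLinearMap.snd ℝ ℝ ℝ))
    have hsplit (L : ℝ × ℝ →L[ℝ] ℝ) (w : ℝ × ℝ) : L w = w.1 * L (1, 0) + w.2 * L (0, 1) := by
      conv_lhs => rw [show w = w.1 • ((1 : ℝ), (0 : ℝ)) + w.2 • ((0 : ℝ), (1 : ℝ)) by ext <;> simp]
      simp only [map_add, map_smul, smul_eq_mul]
    have hcl : fderiv ℝ a p (0, 1) = fderiv ℝ b p (1, 0) := hab p hp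
    rw [hdω.fderiv]
    simp only [add_apply, ContinuousLinearMap.smulRight_apply, smul_apply,
      ContinuousLinearMap.coe_fst', ContinuousLinearMap.coe_snd', smul_eq_mul]
    rw [hsplit (fderiv ℝ a p) u, hsplit (fderiv ℝ a p) v, hsplit (fderiv ℝ b p) u,
      hsplit (fderiv ℝ b p) v, hcl]
    ring)
  refine ⟨f, ?_, fun p hp ↦ ?_, fun p hp ↦ ?_⟩
  · rw [contDiffOn_infty_iff_fderiv_of_isOpen hU]
    exact ⟨fun p hp ↦ (hf p hp).differentiableAt.differentiableWithinAt,
      hω.congr fun p hp ↦ (hf p hp).fderiv⟩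
  · simp [(hf p hp).pdx_eq, ω]
  · simp [(hf p hp).pdy_eq, ω]

/-- If `T` satisfies `T_xx + T_yy = 2T(T_x²+T_y²)/(1+T²)`, then the 1-form
`η = −(1/2) d log(1+T²) + (T_y dx − T_x dy)/(1+T²)`, whose components are
`η₁ = (T_y − T·T_x)/(1+T²)` and `η₂ = −(T_x + T·T_y)/(1+T²)`, is closed;
consequently, on a simply connected domain there is a positive `R` with
`d log R = η`, and this `R` is a common integrating factor for
`ω₁ = T dx + dy` and `ω₂ = −dx + T dy`. -/
theorem eta_closed_and_integrating_factor
    (U : Set (ℝ × ℝ)) (hU : IsOpen U) (hne : U.Nonempty)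
    (hsc : SimplyConnectedSpace U)
    (T : ℝ × ℝ → ℝ) (hT : ContDiffOn ℝ (⊤ : ℕ∞) T U)
    (hpde : ∀ p ∈ U, (pdx (pdx T) p + pdy (pdy T) p) * (1 + (T p) ^ 2)
        = 2 * T p * ((pdx T p) ^ 2 + (pdy T p) ^ 2)) :
    (∀ p ∈ U, pdy (fun q => (pdy T q - T q * pdx T q) / (1 + (T q) ^ 2)) p
        = pdx (fun q => -(pdx T q + T q * pdy T q) / (1 + (T q) ^ 2)) p) ∧
    ∃ R : ℝ × ℝ → ℝ, ContDiffOn ℝ (⊤ : ℕ∞) R U ∧ (∀ p ∈ U, 0 < R p) ∧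
      (∀ p ∈ U, pdx (fun q => Real.log (R q)) p
          = (pdy T p - T p * pdx T p) / (1 + (T p) ^ 2)) ∧
      (∀ p ∈ U, pdy (fun q => Real.log (R q)) p
          = -(pdx T p + T p * pdy T p) / (1 + (T p) ^ 2)) ∧
      (∀ p ∈ U, pdy (fun q => R q * T q) p = pdx R p) ∧
      (∀ p ∈ U, pdy (fun q => -R q) p = pdx (fun q => R q * T q) p) := by
  have hdiff {g : ℝ × ℝ → ℝ} (hg : ContDiffOn ℝ (⊤ : ℕ∞) g U) {p : ℝ × ℝ} (hp : p ∈ U) :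
      HasFDerivAt g (fderiv ℝ g p) p :=
    ((hg.differentiableOn (by simp)).differentiableAt (hU.mem_nhds hp)).hasFDerivAt
  have hTx := hT.pdx hU
  have hTy := hT.pdy hU
  have hpos (p : ℝ × ℝ) : 1 + T p ^ 2 ≠ 0 := by positivity
  have hclosed : ∀ p ∈ U, pdy (fun q => (pdy T q - T q * pdx T q) / (1 + (T q) ^ 2)) p
      = pdx (fun q => -(pdx T q + T q * pdy T q) / (1 + (T q) ^ 2)) p := by
    intro p hp
    have dT := hdiff hT hp
    have dTx := hdiff hTx hp
    have dTy := hdiff hTy hp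
    have dden := (dT.pow 2).const_add 1
    have h1 := (dTy.fun_sub (dT.fun_mul dTx)).real_div dden (hpos p)
    have h2 := (dTx.fun_add (dT.fun_mul dTy)).fun_neg.real_div dden (hpos p)
    have hmix : pdx (pdy T) p = pdy (pdx T) p :=
      pdx_pdy_comm ((hT.contDiffAt (hU.mem_nhds hp)).of_le (by norm_cast))
    have h := hpde p hp
    rw [h1.pdy_eq, h2.pdx_eq]
    simp only [smul_apply, add_apply, sub_apply, neg_apply, smul_eq_mul, ← pdx.eq_1,
      ← pdy.eq_1, hmix]
    field_simp
    simp
    linear_combination h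
  refine ⟨hclosed, ?_⟩
  have hden : ContDiffOn ℝ (⊤ : ℕ∞) (fun q ↦ 1 + T q ^ 2) U := contDiffOn_const.add (hT.pow 2)
  obtain ⟨f, hf, hfx, hfy⟩ := IsSimplyConnected.exists_potential hsc hU
    (a := fun q ↦ (pdy T q - T q * pdx T q) / (1 + (T q) ^ 2))
    (b := fun q ↦ -(pdx T q + T q * pdy T q) / (1 + (T q) ^ 2))
    ((hTy.sub (hT.mul hTx)).div hden fun p _ ↦ hpos p)
    ((hTx.add (hT.mul hTy)).neg.div hden fun p _ ↦ hpos p) hclosed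
  refine ⟨fun p ↦ Real.exp (f p), hf.exp, fun p _ ↦ Real.exp_pos _, ?_, ?_, fun p hp ↦ ?_,
    fun p hp ↦ ?_⟩
  · simpa only [Real.log_exp] using hfx
  · simpa only [Real.log_exp] using hfy
  all_goals
    have dT := hdiff hT hp
    have dR := (hdiff hf hp).exp
    have hx := (eq_div_iff (hpos p)).1 (hfx p hp)
    have hy := (eq_div_iff (hpos p)).1 (hfy p hp)
  · rw [(dR.fun_mul dT).pdy_eq, dR.pdx_eq]
    simp only [smul_apply, add_apply, smul_eq_mul, ← pdx.eq_1, ← pdy.eq_1]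
    refine mul_right_cancel₀ (hpos p) ?_
    linear_combination Real.exp (f p) * (T p * hy - hx)
  · rw [(dR.fun_mul dT).pdx_eq, dR.fun_neg.pdy_eq]
    simp only [smul_apply, add_apply, neg_apply, smul_eq_mul, ← pdx.eq_1, ← pdy.eq_1]
    refine mul_right_cancel₀ (hpos p) ?_
    linear_combination Real.exp (f p) * (-hy - T p * hx)
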